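/- Let 1 < p < ∞. There is a positive constant C, independent of the weight, such that for every weight w and every interval J ⊂ ℝ with ⟨w^{−1/(p−1)}⟩_J finite: (1/|J|) Σ_{I ∈ 𝒟(J)} (Δ_I w / ⟨w⟩_I)² ⟨w⟩_I^{−1/(p−1)} |I| ≤ C ( ⟨w^{−1/(p−1)}⟩_J − ⟨w⟩_J^{−1/(p−1)} ). Moreover, if w is doubling with constant D on J (meaning ⟨w⟩_I ≤ D ⟨w⟩_{I⁺} and ⟨w⟩_I ≤ D ⟨w⟩_{I⁻} for every I ∈ 𝒟(J) and I = J), then there exists a constant c > 0 depending only on p and D such that c ( ⟨w^{−1/(p−1)}⟩_J − ⟨w⟩_J^{−1/(p−1)} ) ≤ (1/|J|) Σ_{I ∈ 𝒟(J)} (Δ_I w / ⟨w⟩_I)² ⟨w⟩_I^{−1/(p−1)} |I|. -/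

import Mathlib

open MeasureTheory Real
open scoped ENNReal

noncomputable section

/-- The average `⟨w⟩_{[a,b]} = (b-a)⁻¹ ∫_a^b w`. -/
def avg (w : ℝ → ℝ) (a b : ℝ) : ℝ := (b - a)⁻¹ * ∫ x in a..b, w x

/-- A weight: a locally integrable function on `ℝ` that is positive almost everywhere. -/
def IsWeight (w : ℝ → ℝ) : Prop :=
  LocallyIntegrable w volume ∧ ∀ᵐ x : ℝ, 0 < w x

/-- Endpoints of the `k`-th subinterval of `[a,b]` at bisection level `n`; as `n, k` range over
`n : ℕ`, `k < 2^n` these enumerate the family `𝒟(J)` obtained from `J = [a,b]` by repeated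
bisection (including `J` itself, for `n = 0`). -/
def subInt (a b : ℝ) (n k : ℕ) : ℝ × ℝ :=
  (a + k * ((b - a) / 2 ^ n), a + (k + 1) * ((b - a) / 2 ^ n))

/-- Midpoint of an interval. -/
def mid (a b : ℝ) : ℝ := (a + b) / 2

/-- `Δ_I w` for `I = [a,b]`: the difference of the averages of `w` over the two halves of `I`. -/
def delta (w : ℝ → ℝ) (a b : ℝ) : ℝ := avg w a (mid a b) - avg w (mid a b) b

/-- `(1/|J|) Σ_{I ∈ 𝒟(J)} (Δ_I w)² g(⟨w⟩_I) |I|` for `J = [a,b]`. -/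
def bellmanSum (w : ℝ → ℝ) (a b : ℝ) (g : ℝ → ℝ) : ℝ :=
  (b - a)⁻¹ * ∑' n : ℕ, ∑ k ∈ Finset.range (2 ^ n),
    delta w (subInt a b n k).1 (subInt a b n k).2 ^ 2 *
      g (avg w (subInt a b n k).1 (subInt a b n k).2) * ((b - a) / 2 ^ n)

/-- `(1/|J|) Σ_{I ∈ 𝒟(J)} (Δ_I w / ⟨w⟩_I)² g(⟨w⟩_I) |I|` for `J = [a,b]`. -/
def buckleySum (w : ℝ → ℝ) (a b : ℝ) (g : ℝ → ℝ) : ℝ :=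
  (b - a)⁻¹ * ∑' n : ℕ, ∑ k ∈ Finset.range (2 ^ n),
    (delta w (subInt a b n k).1 (subInt a b n k).2 /
        avg w (subInt a b n k).1 (subInt a b n k).2) ^ 2 *
      g (avg w (subInt a b n k).1 (subInt a b n k).2) * ((b - a) / 2 ^ n)

/-- `ℝ≥0∞`-valued version of `buckleySum` (the summands are nonnegative). -/
def buckleySumE (w : ℝ → ℝ) (a b : ℝ) (g : ℝ → ℝ) : ℝ≥0∞ :=
  ENNReal.ofReal ((b - a)⁻¹) * ∑' n : ℕ, ∑ k ∈ Finset.range (2 ^ n),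
    ENNReal.ofReal
      ((delta w (subInt a b n k).1 (subInt a b n k).2 /
          avg w (subInt a b n k).1 (subInt a b n k).2) ^ 2 *
        g (avg w (subInt a b n k).1 (subInt a b n k).2) * ((b - a) / 2 ^ n))

/-- `w` is doubling with constant `D` on the bisection family of `[a,b]`:
`⟨w⟩_I ≤ D ⟨w⟩_{I⁺}` and `⟨w⟩_I ≤ D ⟨w⟩_{I⁻}` for every `I ∈ 𝒟(J)` (including `I = J`). -/
def DoublingOn (D : ℝ) (w : ℝ → ℝ) (a b : ℝ) : Prop :=
  ∀ n : ℕ, ∀ k < 2 ^ n,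
    avg w (subInt a b n k).1 (subInt a b n k).2 ≤
        D * avg w (subInt a b n k).1 (mid (subInt a b n k).1 (subInt a b n k).2) ∧
      avg w (subInt a b n k).1 (subInt a b n k).2 ≤
        D * avg w (mid (subInt a b n k).1 (subInt a b n k).2) (subInt a b n k).2

/-- Endpoints of the dyadic interval `[k·2^{-j}, (k+1)·2^{-j})` of the grid `𝒟`. -/
def dyad (j k : ℤ) : ℝ × ℝ := ((k : ℝ) * (2 : ℝ) ^ (-j), ((k : ℝ) + 1) * (2 : ℝ) ^ (-j))

/-- `w` is dyadically doubling with constant `D`: the average over any dyadic interval is at most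
`D` times the average over each of its two dyadic children, i.e. `⟨w⟩_{F(I)} ≤ D ⟨w⟩_I` for every
`I ∈ 𝒟` with dyadic parent `F(I)`. -/
def DyadicDoubling (D : ℝ) (w : ℝ → ℝ) : Prop :=
  ∀ j k : ℤ,
    avg w (dyad j k).1 (dyad j k).2 ≤
        D * avg w (dyad (j + 1) (2 * k)).1 (dyad (j + 1) (2 * k)).2 ∧
      avg w (dyad j k).1 (dyad j k).2 ≤
        D * avg w (dyad (j + 1) (2 * k + 1)).1 (dyad (j + 1) (2 * k + 1)).2

/-! ### Power inequalities -/

lemma one_sub_mul_le_rpow_neg {s x : ℝ} (hs : 0 < s) (hx : 0 < x) :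
    1 - s * (x - 1) ≤ x ^ (-s) := by
  rw [rpow_def_of_pos hx]
  nlinarith [add_one_le_exp (log x * -s), log_le_sub_one_of_pos hx]

lemma rpow_neg_le_one_add {s x : ℝ} (hs : 0 < s) (hx : 0 < x) :
    x ^ (-s) ≤ 1 + s * x ^ (-(s + 1)) * (1 - x) := by
  have h := one_sub_mul_le_rpow_neg hs (inv_pos.2 hx)
  have hm := mul_le_mul_of_nonneg_left h (rpow_pos_of_pos hx (-s)).le
  rw [inv_rpow hx.le, mul_inv_cancel₀ (rpow_pos_of_pos hx _).ne'] at hm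
  have e : x ^ (-(s + 1)) = x ^ (-s) * x⁻¹ := by
    rw [neg_add, rpow_add hx, rpow_neg_one]
  have e2 : s * (x ^ (-s) * x⁻¹) * (1 - x) = x ^ (-s) * (s * (x⁻¹ - 1)) := by
    field_simp
  rw [e, e2]
  linarith

lemma rpow_neg_le_quadratic {s x δ : ℝ} (hs : 0 < s) (hδ : 0 < δ) (hδ1 : δ ≤ 1) (hx : δ ≤ x) :
    x ^ (-s) ≤ 1 - s * (x - 1) + s * (s + 1) * δ ^ (-(s + 1 + 1)) * (x - 1) ^ 2 := by
  have hx0 : 0 < x := hδ.trans_le hx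
  have hr : 0 < s + 1 := by linarith
  have hK : 1 ≤ δ ^ (-(s + 1 + 1)) :=
    one_le_rpow_of_pos_of_le_one_of_nonpos hδ hδ1 (by linarith)
  have h1 := rpow_neg_le_one_add hs hx0
  suffices h : (1 - x) * (x ^ (-(s + 1)) - 1) ≤
      (s + 1) * δ ^ (-(s + 1 + 1)) * (x - 1) ^ 2 by
    nlinarith [mul_le_mul_of_nonneg_left h hs.le]
  rcases le_total x 1 with h | h
  · have h2 := rpow_neg_le_one_add hr hx0
    have h3 : x ^ (-(s + 1 + 1)) ≤ δ ^ (-(s + 1 + 1)) :=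
      rpow_le_rpow_of_nonpos hδ hx (by linarith)
    have h4 : x ^ (-(s + 1)) - 1 ≤ (s + 1) * δ ^ (-(s + 1 + 1)) * (1 - x) := by
      have := mul_le_mul_of_nonneg_left h3 (mul_nonneg hr.le (sub_nonneg.2 h))
      linarith
    have := mul_le_mul_of_nonneg_left h4 (sub_nonneg.2 h)
    linarith
  · have h2 := one_sub_mul_le_rpow_neg hr hx0
    have h5 : 0 ≤ (s + 1) * (x - 1) ^ 2 := by positivity
    nlinarith [mul_le_mul_of_nonneg_left h2 (sub_nonneg.2 h), mul_le_mul_of_nonneg_left hK h5]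

/-- The tangent line inequality for the convex function `y ↦ y ^ (-s)`. -/
lemma tangent_le_rpow_neg {s m y : ℝ} (hs : 0 < s) (hm : 0 < m) (hy : 0 < y) :
    m ^ (-s) - s * m ^ (-s) / m * (y - m) ≤ y ^ (-s) := by
  have h := mul_le_mul_of_nonneg_left (one_sub_mul_le_rpow_neg hs (div_pos hy hm))
    (rpow_pos_of_pos hm (-s)).le
  rw [← mul_rpow hm.le (div_pos hy hm).le, mul_div_cancel₀ _ hm.ne'] at h
  refine le_trans (le_of_eq ?_) h
  field_simp

lemma rpow_neg_eq_mul_div {s m u : ℝ} (hm : 0 < m) (hu : 0 < u) :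
    u ^ (-s) = m ^ (-s) * (u / m) ^ (-s) := by
  rw [← mul_rpow hm.le (div_pos hu hm).le, mul_div_cancel₀ _ hm.ne']

lemma mul_sq_le_midpoint_gap {s m u v : ℝ} (hs : 0 < s) (hu : 0 < u) (hv : 0 < v)
    (h : u + v = 2 * m) :
    s / 8 * (((u - v) / m) ^ 2 * m ^ (-s)) ≤ (u ^ (-s) + v ^ (-s)) / 2 - m ^ (-s) := by
  have hm : 0 < m := by linarith
  rw [rpow_neg_eq_mul_div hm hu, rpow_neg_eq_mul_div hm hv, sub_div]
  have hx : 0 < u / m := div_pos hu hm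
  have hy : 0 < v / m := div_pos hv hm
  have hxy : u / m + v / m = 2 := by rw [← add_div, h]; field_simp
  generalize u / m = x at *
  generalize v / m = y at *
  have key : s / 8 * (x - y) ^ 2 ≤ (x ^ (-s) + y ^ (-s)) / 2 - 1 := by
    rw [rpow_def_of_pos hx, rpow_def_of_pos hy]
    have h1 := add_one_le_exp (log x * -s)
    have h2 := add_one_le_exp (log y * -s)
    have h3 := log_le_sub_one_of_pos (mul_pos hx hy)
    rw [log_mul hx.ne' hy.ne'] at h3
    obtain rfl : y = 2 - x := by linarith
    nlinarith
  nlinarith [mul_le_mul_of_nonneg_left key (rpow_pos_of_pos hm (-s)).le]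

lemma midpoint_gap_le_mul_sq {s m u v δ : ℝ} (hs : 0 < s) (hδ : 0 < δ) (hδ1 : δ ≤ 1)
    (hm : 0 < m) (hu : δ * m ≤ u) (hv : δ * m ≤ v) (h : u + v = 2 * m) :
    (u ^ (-s) + v ^ (-s)) / 2 - m ^ (-s) ≤
      s * (s + 1) * δ ^ (-(s + 1 + 1)) / 4 * (((u - v) / m) ^ 2 * m ^ (-s)) := by
  have hδm := mul_pos hδ hm
  rw [rpow_neg_eq_mul_div hm (hδm.trans_le hu), rpow_neg_eq_mul_div hm (hδm.trans_le hv), sub_div]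
  have hx : δ ≤ u / m := (le_div_iff₀ hm).2 hu
  have hy : δ ≤ v / m := (le_div_iff₀ hm).2 hv
  have hxy : u / m + v / m = 2 := by rw [← add_div, h]; field_simp
  generalize u / m = x at *
  generalize v / m = y at *
  have h1 := rpow_neg_le_quadratic hs hδ hδ1 hx
  have h2 := rpow_neg_le_quadratic hs hδ hδ1 hy
  generalize s * (s + 1) * δ ^ (-(s + 1 + 1)) = K at *
  have key : (x ^ (-s) + y ^ (-s)) / 2 - 1 ≤ K / 4 * (x - y) ^ 2 := by
    obtain rfl : y = 2 - x := by linarith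
    nlinarith
  nlinarith [mul_le_mul_of_nonneg_left key (rpow_pos_of_pos hm (-s)).le]

/-! ### Averages of weights -/

lemma IsWeight.intervalIntegrable {w : ℝ → ℝ} (hw : IsWeight w) (a b : ℝ) :
    IntervalIntegrable w volume a b :=
  (hw.1.integrableOn_isCompact isCompact_uIcc).intervalIntegrable

lemma IsWeight.avg_pos {w : ℝ → ℝ} (hw : IsWeight w) {a b : ℝ} (hab : a < b) : 0 < avg w a b := by
  refine mul_pos (inv_pos.2 (sub_pos.2 hab)) ?_
  refine (intervalIntegral.integral_pos_iff_support_of_nonneg_ae'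
    (ae_restrict_of_ae (hw.2.mono fun x hx => hx.le)) (hw.intervalIntegrable a b)).2 ⟨hab, ?_⟩
  have h : (Set.Ioc a b : Set ℝ) ≤ᵐ[volume] (Function.support w ∩ Set.Ioc a b : Set ℝ) :=
    hw.2.mono fun x hx hxI => ⟨hx.ne', hxI⟩
  refine lt_of_lt_of_le ?_ (measure_mono_ae h)
  simpa using hab

lemma integral_eq_mul_avg (w : ℝ → ℝ) {a b : ℝ} (hab : a < b) :
    ∫ x in a..b, w x = (b - a) * avg w a b := by
  rw [avg, mul_inv_cancel_left₀ (sub_pos.2 hab).ne']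

lemma IsWeight.avg_add_avg {w : ℝ → ℝ} (hw : IsWeight w) {a b : ℝ} (hab : a < b) :
    avg w a (mid a b) + avg w (mid a b) b = 2 * avg w a b := by
  have h := intervalIntegral.integral_add_adjacent_intervals
    (hw.intervalIntegrable a (mid a b)) (hw.intervalIntegrable (mid a b) b)
  have h1 : mid a b - a = (b - a) / 2 := by rw [mid]; ring
  have h2 : b - mid a b = (b - a) / 2 := by rw [mid]; ring
  rw [avg, avg, avg, ← h, h1, h2]
  have := (sub_pos.2 hab).ne'
  field_simp

/-- Jensen's inequality for `y ↦ y ^ (-s)`. -/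
lemma IsWeight.mul_avg_rpow_neg_le_integral {w : ℝ → ℝ} (hw : IsWeight w) {a b s : ℝ}
    (hab : a < b) (hs : 0 < s) (hi : IntervalIntegrable (fun x => w x ^ (-s)) volume a b) :
    (b - a) * avg w a b ^ (-s) ≤ ∫ x in a..b, w x ^ (-s) := by
  have hm := hw.avg_pos hab
  set m := avg w a b with hmdef
  have hwi := hw.intervalIntegrable a b
  have hl : IntervalIntegrable (fun x => s * m ^ (-s) / m * (w x - m)) volume a b :=
    (hwi.sub intervalIntegrable_const).const_mul _
  have h := intervalIntegral.integral_mono_ae hab.le (intervalIntegrable_const.sub hl) hi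
    (hw.2.mono fun x hx => tangent_le_rpow_neg hs hm hx)
  refine le_trans (le_of_eq ?_) h
  rw [intervalIntegral.integral_sub intervalIntegrable_const hl,
    intervalIntegral.integral_const_mul, intervalIntegral.integral_sub hwi intervalIntegrable_const,
    integral_eq_mul_avg w hab, ← hmdef]
  simp

/-! ### Bisection -/

lemma subInt_lt {a b : ℝ} (hab : a < b) (n k : ℕ) : (subInt a b n k).1 < (subInt a b n k).2 := by
  have : 0 < (b - a) / 2 ^ n := div_pos (sub_pos.2 hab) (by positivity)
  simp only [subInt]
  linarith

lemma subInt_sub (a b : ℝ) (n k : ℕ) :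
    (subInt a b n k).2 - (subInt a b n k).1 = (b - a) / 2 ^ n := by
  simp only [subInt]
  ring

lemma subInt_fst_succ (a b : ℝ) (n k : ℕ) : (subInt a b n (k + 1)).1 = (subInt a b n k).2 := by
  simp [subInt]

lemma subInt_fst_zero (a b : ℝ) (n : ℕ) : (subInt a b n 0).1 = a := by
  simp [subInt]

lemma subInt_fst_two_pow (a b : ℝ) (n : ℕ) : (subInt a b n (2 ^ n)).1 = b := by
  simp only [subInt]
  push_cast
  field_simp
  ring

lemma subInt_even (a b : ℝ) (n k : ℕ) :
    subInt a b (n + 1) (2 * k) =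
      ((subInt a b n k).1, mid (subInt a b n k).1 (subInt a b n k).2) := by
  simp only [subInt, mid, Prod.mk.injEq]
  push_cast
  constructor <;> field_simp <;> ring

lemma subInt_odd (a b : ℝ) (n k : ℕ) :
    subInt a b (n + 1) (2 * k + 1) =
      (mid (subInt a b n k).1 (subInt a b n k).2, (subInt a b n k).2) := by
  simp only [subInt, mid, Prod.mk.injEq]
  push_cast
  constructor <;> field_simp <;> ring

lemma sum_integral_subInt {f : ℝ → ℝ} {a b : ℝ} {n : ℕ}
    (hf : ∀ k < 2 ^ n, IntervalIntegrable f volume (subInt a b n k).1 (subInt a b n k).2) :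
    ∑ k ∈ Finset.range (2 ^ n), ∫ x in (subInt a b n k).1..(subInt a b n k).2, f x =
      ∫ x in a..b, f x := by
  have h := intervalIntegral.sum_integral_adjacent_intervals (f := f) (μ := volume)
    (a := fun k => (subInt a b n k).1) (n := 2 ^ n)
    (fun k hk => by simpa only [subInt_fst_succ] using hf k hk)
  simpa only [subInt_fst_succ, subInt_fst_zero, subInt_fst_two_pow] using h

lemma subInt_subset {a b : ℝ} (hab : a < b) {n k : ℕ} (hk : k < 2 ^ n) :
    Set.Icc (subInt a b n k).1 (subInt a b n k).2 ⊆ Set.Icc a b := by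
  have h0 : 0 < (b - a) / 2 ^ n := div_pos (sub_pos.2 hab) (by positivity)
  refine Set.Icc_subset_Icc ?_ ?_
  · simp only [subInt]
    nlinarith [(Nat.cast_nonneg k : (0 : ℝ) ≤ k)]
  · have h1 : ((k : ℝ) + 1) ≤ 2 ^ n := by exact_mod_cast hk
    have h2 := mul_le_mul_of_nonneg_right h1 h0.le
    rw [mul_div_cancel₀ _ (by positivity)] at h2
    simp only [subInt]
    linarith

lemma sum_range_two_mul (f : ℕ → ℝ) (m : ℕ) :
    ∑ k ∈ Finset.range (2 * m), f k = ∑ k ∈ Finset.range m, (f (2 * k) + f (2 * k + 1)) := by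
  induction m with
  | zero => simp
  | succ m ih => rw [Nat.mul_succ, Finset.sum_range_succ, Finset.sum_range_succ, ih,
      Finset.sum_range_succ, add_assoc]

/-- The integral over `[a,b]` of `g` composed with the level-`n` conditional expectation of `w`. -/
def levelSum (w : ℝ → ℝ) (a b : ℝ) (g : ℝ → ℝ) (n : ℕ) : ℝ :=
  ∑ k ∈ Finset.range (2 ^ n),
    g (avg w (subInt a b n k).1 (subInt a b n k).2) * ((b - a) / 2 ^ n)

/-- The contribution of the level-`n` intervals to `buckleySum`, without the factor `1/|J|`. -/
def buckleyLevel (w : ℝ → ℝ) (a b : ℝ) (g : ℝ → ℝ) (n : ℕ) : ℝ :=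
  ∑ k ∈ Finset.range (2 ^ n),
    (delta w (subInt a b n k).1 (subInt a b n k).2 /
        avg w (subInt a b n k).1 (subInt a b n k).2) ^ 2 *
      g (avg w (subInt a b n k).1 (subInt a b n k).2) * ((b - a) / 2 ^ n)

lemma levelSum_zero (w : ℝ → ℝ) (a b : ℝ) (g : ℝ → ℝ) :
    levelSum w a b g 0 = (b - a) * g (avg w a b) := by
  simp [levelSum, subInt, mul_comm]

lemma levelSum_succ_sub (w : ℝ → ℝ) (a b : ℝ) (g : ℝ → ℝ) (n : ℕ) :
    levelSum w a b g (n + 1) - levelSum w a b g n = ∑ k ∈ Finset.range (2 ^ n),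
      ((g (avg w (subInt a b n k).1 (mid (subInt a b n k).1 (subInt a b n k).2)) +
          g (avg w (mid (subInt a b n k).1 (subInt a b n k).2) (subInt a b n k).2)) / 2 -
        g (avg w (subInt a b n k).1 (subInt a b n k).2)) * ((b - a) / 2 ^ n) := by
  rw [levelSum, levelSum, pow_succ', sum_range_two_mul, ← Finset.sum_sub_distrib]
  refine Finset.sum_congr rfl fun k _ => ?_
  rw [subInt_even, subInt_odd]
  field_simp
  ring

lemma lt_mid {a b : ℝ} (hab : a < b) : a < mid a b := by
  rw [mid]; linarith

lemma mid_lt {a b : ℝ} (hab : a < b) : mid a b < b := by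
  rw [mid]; linarith

lemma buckleyLevel_nonneg {w : ℝ → ℝ} (hw : IsWeight w) {a b : ℝ} (hab : a < b) (s : ℝ) (n : ℕ) :
    0 ≤ buckleyLevel w a b (fun x => x ^ (-s)) n := by
  have h0 : 0 < (b - a) / 2 ^ n := div_pos (sub_pos.2 hab) (by positivity)
  exact Finset.sum_nonneg fun k _ => mul_nonneg (mul_nonneg (sq_nonneg _)
    (rpow_nonneg (hw.avg_pos (subInt_lt hab n k)).le _)) h0.le

lemma mul_buckleyLevel_le {w : ℝ → ℝ} (hw : IsWeight w) {a b s : ℝ} (hab : a < b) (hs : 0 < s)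
    (n : ℕ) :
    s / 8 * buckleyLevel w a b (fun x => x ^ (-s)) n ≤
      levelSum w a b (fun x => x ^ (-s)) (n + 1) - levelSum w a b (fun x => x ^ (-s)) n := by
  have h0 : 0 < (b - a) / 2 ^ n := div_pos (sub_pos.2 hab) (by positivity)
  rw [levelSum_succ_sub, buckleyLevel, Finset.mul_sum]
  refine Finset.sum_le_sum fun k _ => ?_
  have hI := subInt_lt hab n k
  rw [← mul_assoc]
  exact mul_le_mul_of_nonneg_right (mul_sq_le_midpoint_gap hs (hw.avg_pos (lt_mid hI))
    (hw.avg_pos (mid_lt hI)) (hw.avg_add_avg hI)) h0.le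

lemma le_mul_buckleyLevel {w : ℝ → ℝ} (hw : IsWeight w) {a b s δ : ℝ} (hab : a < b) (hs : 0 < s)
    (hδ : 0 < δ) (hδ1 : δ ≤ 1) (hd : DoublingOn δ⁻¹ w a b) (n : ℕ) :
    levelSum w a b (fun x => x ^ (-s)) (n + 1) - levelSum w a b (fun x => x ^ (-s)) n ≤
      s * (s + 1) * δ ^ (-(s + 1 + 1)) / 4 * buckleyLevel w a b (fun x => x ^ (-s)) n := by
  have h0 : 0 < (b - a) / 2 ^ n := div_pos (sub_pos.2 hab) (by positivity)
  rw [levelSum_succ_sub, buckleyLevel, Finset.mul_sum]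
  refine Finset.sum_le_sum fun k hk => ?_
  have hI := subInt_lt hab n k
  obtain ⟨h1, h2⟩ := hd n k (Finset.mem_range.1 hk)
  rw [← mul_assoc]
  exact mul_le_mul_of_nonneg_right (midpoint_gap_le_mul_sq hs hδ hδ1 (hw.avg_pos hI)
    ((le_inv_mul_iff₀ hδ).1 h1) ((le_inv_mul_iff₀ hδ).1 h2) (hw.avg_add_avg hI)) h0.le

lemma levelSum_le_integral {w : ℝ → ℝ} (hw : IsWeight w) {a b s : ℝ} (hab : a < b) (hs : 0 < s)
    (hi : IntervalIntegrable (fun x => w x ^ (-s)) volume a b) (n : ℕ) :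
    levelSum w a b (fun x => x ^ (-s)) n ≤ ∫ x in a..b, w x ^ (-s) := by
  have hik : ∀ k < 2 ^ n, IntervalIntegrable (fun x => w x ^ (-s)) volume
      (subInt a b n k).1 (subInt a b n k).2 := fun k hk => hi.mono_set (by
    rw [Set.uIcc_of_le (subInt_lt hab n k).le, Set.uIcc_of_le hab.le]
    exact subInt_subset hab hk)
  rw [← sum_integral_subInt hik, levelSum]
  refine Finset.sum_le_sum fun k hk => ?_
  have h := hw.mul_avg_rpow_neg_le_integral (subInt_lt hab n k) hs (hik k (Finset.mem_range.1 hk))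
  rwa [subInt_sub, mul_comm] at h

/-! ### Convergence of the level averages -/

/-- The index of the level-`n` interval containing `x`. -/
def subIdx (a b : ℝ) (n : ℕ) (x : ℝ) : ℕ := ⌊(x - a) / ((b - a) / 2 ^ n)⌋₊

/-- The level-`n` conditional expectation of `w`. -/
def levelAvg (w : ℝ → ℝ) (a b : ℝ) (n : ℕ) (x : ℝ) : ℝ :=
  avg w (subInt a b n (subIdx a b n x)).1 (subInt a b n (subIdx a b n x)).2

lemma measurable_levelAvg (w : ℝ → ℝ) (a b : ℝ) (n : ℕ) : Measurable (levelAvg w a b n) := by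
  have h1 : Measurable (subIdx a b n) :=
    Nat.measurable_floor.comp ((measurable_id.sub_const a).div_const _)
  exact (measurable_from_top
    (f := fun k : ℕ => avg w (subInt a b n k).1 (subInt a b n k).2)).comp h1

lemma subIdx_eq {a b : ℝ} (hab : a < b) {n k : ℕ} {x : ℝ}
    (hx : x ∈ Set.Ioo (subInt a b n k).1 (subInt a b n k).2) : subIdx a b n x = k := by
  have h0 : 0 < (b - a) / 2 ^ n := div_pos (sub_pos.2 hab) (by positivity)
  simp only [subInt, Set.mem_Ioo] at hx
  have h1 : (k : ℝ) ≤ (x - a) / ((b - a) / 2 ^ n) := by rw [le_div_iff₀ h0]; linarith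
  refine (Nat.floor_eq_iff (k.cast_nonneg.trans h1)).2 ⟨h1, ?_⟩
  rw [div_lt_iff₀ h0]
  linarith

lemma mem_subInt_subIdx {a b : ℝ} (hab : a < b) (n : ℕ) {x : ℝ} (hx : a ≤ x) :
    x ∈ Set.Icc (subInt a b n (subIdx a b n x)).1 (subInt a b n (subIdx a b n x)).2 := by
  have h0 : 0 < (b - a) / 2 ^ n := div_pos (sub_pos.2 hab) (by positivity)
  have h1 := Nat.floor_le (div_nonneg (sub_nonneg.2 hx) h0.le)
  have h2 := Nat.lt_floor_add_one ((x - a) / ((b - a) / 2 ^ n))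
  rw [le_div_iff₀ h0] at h1
  rw [div_lt_iff₀ h0] at h2
  simp only [subInt, subIdx, Set.mem_Icc]
  constructor <;> linarith

lemma intervalIntegrable_comp_levelAvg_subInt (w : ℝ → ℝ) {a b : ℝ} (hab : a < b)
    (g : ℝ → ℝ) (n k : ℕ) :
    IntervalIntegrable (fun x => g (levelAvg w a b n x)) volume
      (subInt a b n k).1 (subInt a b n k).2 := by
  refine (intervalIntegrable_const
    (c := g (avg w (subInt a b n k).1 (subInt a b n k).2))).congr_uIoo fun x hx => ?_
  rw [Set.uIoo_of_le (subInt_lt hab n k).le] at hx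
  simp only [levelAvg, subIdx_eq hab hx]

lemma integral_comp_levelAvg (w : ℝ → ℝ) {a b : ℝ} (hab : a < b) (g : ℝ → ℝ) (n : ℕ) :
    ∫ x in a..b, g (levelAvg w a b n x) = levelSum w a b g n := by
  rw [← sum_integral_subInt fun k _ => intervalIntegrable_comp_levelAvg_subInt w hab g n k, levelSum]
  refine Finset.sum_congr rfl fun k _ => ?_
  rw [intervalIntegral.integral_congr_uIoo
    (g := fun _ => g (avg w (subInt a b n k).1 (subInt a b n k).2)) fun x hx => ?_]
  · rw [intervalIntegral.integral_const, subInt_sub, smul_eq_mul, mul_comm]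
  · rw [Set.uIoo_of_le (subInt_lt hab n k).le] at hx
    simp only [levelAvg, subIdx_eq hab hx]

lemma intervalIntegrable_comp_levelAvg (w : ℝ → ℝ) {a b : ℝ} (hab : a < b) (g : ℝ → ℝ)
    (n : ℕ) : IntervalIntegrable (fun x => g (levelAvg w a b n x)) volume a b := by
  have h := IntervalIntegrable.trans_iterate (f := fun x => g (levelAvg w a b n x)) (μ := volume)
    (a := fun k => (subInt a b n k).1) (n := 2 ^ n) (fun k _ => by
      simpa only [subInt_fst_succ] using intervalIntegrable_comp_levelAvg_subInt w hab g n k)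
  simpa only [subInt_fst_zero, subInt_fst_two_pow] using h

lemma avg_eq_average_closedBall (w : ℝ → ℝ) {a b : ℝ} (hab : a < b) :
    avg w a b = ⨍ y in Metric.closedBall (mid a b) ((b - a) / 2), w y := by
  have h1 : mid a b - (b - a) / 2 = a := by rw [mid]; ring
  have h2 : mid a b + (b - a) / 2 = b := by rw [mid]; ring
  rw [Real.closedBall_eq_Icc, h1, h2, setAverage_eq, avg, integral_Icc_eq_integral_Ioc,
    intervalIntegral.integral_of_le hab.le, Real.volume_real_Icc_of_le hab.le, smul_eq_mul]

/-- Lebesgue differentiation along the bisection family. -/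
lemma ae_tendsto_levelAvg {w : ℝ → ℝ} (hw : LocallyIntegrable w volume) {a b : ℝ} (hab : a < b) :
    ∀ᵐ x : ℝ, a ≤ x →
      Filter.Tendsto (fun n => levelAvg w a b n x) Filter.atTop (nhds (w x)) := by
  filter_upwards [IsUnifLocDoublingMeasure.ae_tendsto_average volume hw 1] with x hx hax
  have h := hx (l := Filter.atTop)
    (fun n : ℕ => mid (subInt a b n (subIdx a b n x)).1 (subInt a b n (subIdx a b n x)).2)
    (fun n : ℕ => ((subInt a b n (subIdx a b n x)).2 - (subInt a b n (subIdx a b n x)).1) / 2)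
    ?_ ?_
  · refine h.congr fun n => ?_
    rw [levelAvg, avg_eq_average_closedBall w (subInt_lt hab n _)]
  · simp only [subInt_sub]
    refine tendsto_nhdsWithin_iff.2 ⟨?_, Filter.Eventually.of_forall fun n =>
      half_pos (div_pos (sub_pos.2 hab) (by positivity))⟩
    have h := (tendsto_pow_atTop_nhds_zero_of_lt_one (r := (1 / 2 : ℝ)) (by norm_num)
      (by norm_num)).const_mul ((b - a) / 2)
    rw [mul_zero] at h
    refine h.congr fun n => ?_
    rw [one_div, inv_pow]
    field_simp
  · refine Filter.Eventually.of_forall fun n => ?_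
    have h := mem_subInt_subIdx hab n hax
    rw [Real.closedBall_eq_Icc]
    simp only [Set.mem_Icc, mid] at h ⊢
    constructor <;> linarith

lemma integral_le_of_levelSum_le {w : ℝ → ℝ} (hw : IsWeight w) {a b s M : ℝ} (hab : a < b)
    (hi : IntervalIntegrable (fun x => w x ^ (-s)) volume a b)
    (hM : ∀ n, levelSum w a b (fun x => x ^ (-s)) n ≤ M) :
    ∫ x in a..b, w x ^ (-s) ≤ M := by
  have hpos : ∀ n, ∀ x, 0 ≤ levelAvg w a b n x ^ (-s) := fun n x =>
    rpow_nonneg (hw.avg_pos (subInt_lt hab _ _)).le _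
  have hM0 : 0 ≤ M := by
    refine le_trans ?_ (hM 0)
    rw [← integral_comp_levelAvg w hab]
    exact intervalIntegral.integral_nonneg hab.le fun x _ => hpos 0 x
  have hlev : ∀ n, ∫⁻ x in Set.Ioc a b, ENNReal.ofReal (levelAvg w a b n x ^ (-s)) ≤
      ENNReal.ofReal M := fun n => by
    rw [← ofReal_integral_eq_lintegral_ofReal
      (intervalIntegrable_comp_levelAvg w hab (fun x => x ^ (-s)) n).1
      (Filter.Eventually.of_forall (hpos n)), ← intervalIntegral.integral_of_le hab.le,
      integral_comp_levelAvg w hab (fun x => x ^ (-s))]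
    exact ENNReal.ofReal_le_ofReal (hM n)
  rw [← ENNReal.ofReal_le_ofReal_iff hM0, intervalIntegral.integral_of_le hab.le,
    ofReal_integral_eq_lintegral_ofReal hi.1
      (ae_restrict_of_ae (hw.2.mono fun x hx => rpow_nonneg hx.le _))]
  calc ∫⁻ x in Set.Ioc a b, ENNReal.ofReal (w x ^ (-s))
      = ∫⁻ x in Set.Ioc a b, Filter.liminf
          (fun n => ENNReal.ofReal (levelAvg w a b n x ^ (-s))) Filter.atTop := by
        refine setLIntegral_congr_fun_ae measurableSet_Ioc ?_
        filter_upwards [hw.2, ae_tendsto_levelAvg hw.1 hab] with x hx ht hxI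
        exact ((ENNReal.continuous_ofReal.tendsto _).comp
          ((ht hxI.1.le).rpow_const (Or.inl hx.ne'))).liminf_eq.symm
    _ ≤ Filter.liminf (fun n => ∫⁻ x in Set.Ioc a b,
          ENNReal.ofReal (levelAvg w a b n x ^ (-s))) Filter.atTop :=
        lintegral_liminf_le fun n => ((measurable_levelAvg w a b n).pow_const _).ennreal_ofReal
    _ ≤ ENNReal.ofReal M :=
        Filter.liminf_le_of_frequently_le' (Filter.Frequently.of_forall hlev)

lemma mul_sum_buckleyLevel_le {w : ℝ → ℝ} (hw : IsWeight w) {a b s : ℝ} (hab : a < b)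
    (hs : 0 < s) (hi : IntervalIntegrable (fun x => w x ^ (-s)) volume a b) (N : ℕ) :
    ∑ n ∈ Finset.range N, buckleyLevel w a b (fun x => x ^ (-s)) n ≤
      8 / s * ((∫ x in a..b, w x ^ (-s)) - (b - a) * avg w a b ^ (-s)) := by
  have h := Finset.sum_le_sum fun n (_ : n ∈ Finset.range N) => mul_buckleyLevel_le hw hab hs n
  rw [Finset.sum_range_sub, levelSum_zero, ← Finset.mul_sum] at h
  have h1 := levelSum_le_integral hw hab hs hi N
  rw [div_mul_eq_mul_div, le_div_iff₀ hs]
  linarith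

lemma sub_le_mul_tsum_buckleyLevel {w : ℝ → ℝ} (hw : IsWeight w) {a b s δ : ℝ} (hab : a < b)
    (hs : 0 < s) (hi : IntervalIntegrable (fun x => w x ^ (-s)) volume a b)
    (hδ : 0 < δ) (hδ1 : δ ≤ 1) (hd : DoublingOn δ⁻¹ w a b) :
    (∫ x in a..b, w x ^ (-s)) - (b - a) * avg w a b ^ (-s) ≤
      s * (s + 1) * δ ^ (-(s + 1 + 1)) / 4 * ∑' n, buckleyLevel w a b (fun x => x ^ (-s)) n := by
  have hsum := summable_of_sum_range_le (buckleyLevel_nonneg hw hab s)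
    (mul_sum_buckleyLevel_le hw hab hs hi)
  rw [sub_le_iff_le_add]
  refine integral_le_of_levelSum_le hw hab hi fun N => ?_
  have h := Finset.sum_le_sum fun n (_ : n ∈ Finset.range N) =>
    le_mul_buckleyLevel hw hab hs hδ hδ1 hd n
  rw [Finset.sum_range_sub, levelSum_zero, ← Finset.mul_sum] at h
  have h1 := hsum.sum_le_tsum (Finset.range N) fun n _ => buckleyLevel_nonneg hw hab s n
  have hK : 0 ≤ s * (s + 1) * δ ^ (-(s + 1 + 1)) / 4 := by positivity
  linarith [mul_le_mul_of_nonneg_left h1 hK]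

lemma DoublingOn.mono {w : ℝ → ℝ} (hw : IsWeight w) {a b D E : ℝ} (hab : a < b) (hDE : D ≤ E)
    (hd : DoublingOn D w a b) : DoublingOn E w a b := fun n k hk => by
  have hI := subInt_lt hab n k
  exact ⟨(hd n k hk).1.trans (mul_le_mul_of_nonneg_right hDE (hw.avg_pos (lt_mid hI)).le),
    (hd n k hk).2.trans (mul_le_mul_of_nonneg_right hDE (hw.avg_pos (mid_lt hI)).le)⟩

lemma avg_sub_eq (f : ℝ → ℝ) {a b : ℝ} (hab : a < b) (c : ℝ) :
    avg f a b - c = (b - a)⁻¹ * ((∫ x in a..b, f x) - (b - a) * c) := by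
  rw [mul_sub, inv_mul_cancel_left₀ (sub_pos.2 hab).ne', avg]

/-- Theorem II.6, case `A(x) = x^{-1/(p-1)}`. -/
theorem buckleySum_comparable_neg_rpow (p : ℝ) (hp : 1 < p) :
    (∃ C : ℝ, 0 < C ∧ ∀ w : ℝ → ℝ, IsWeight w → ∀ a b : ℝ, a < b →
      IntervalIntegrable (fun x => w x ^ (-1 / (p - 1))) volume a b →
      buckleySum w a b (fun x => x ^ (-1 / (p - 1))) ≤
        C * (avg (fun x => w x ^ (-1 / (p - 1))) a b - avg w a b ^ (-1 / (p - 1)))) ∧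
    ∀ D : ℝ, ∃ c : ℝ, 0 < c ∧ ∀ w : ℝ → ℝ, IsWeight w → ∀ a b : ℝ, a < b →
      IntervalIntegrable (fun x => w x ^ (-1 / (p - 1))) volume a b →
      DoublingOn D w a b →
      c * (avg (fun x => w x ^ (-1 / (p - 1))) a b - avg w a b ^ (-1 / (p - 1))) ≤
        buckleySum w a b (fun x => x ^ (-1 / (p - 1))) := by
  have hs : 0 < 1 / (p - 1) := one_div_pos.2 (sub_pos.2 hp)
  rw [neg_div]
  generalize 1 / (p - 1) = s at hs ⊢
  refine ⟨⟨8 / s, by positivity, fun w hw a b hab hi => ?_⟩, fun D => ?_⟩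
  · have h := Real.tsum_le_of_sum_range_le (buckleyLevel_nonneg hw hab s)
      (mul_sum_buckleyLevel_le hw hab hs hi)
    have h' := mul_le_mul_of_nonneg_left h (inv_pos.2 (sub_pos.2 hab)).le
    rwa [mul_left_comm, ← avg_sub_eq _ hab] at h'
  · have hδ : 0 < (max D 1)⁻¹ := inv_pos.2 (zero_lt_one.trans_le (le_max_right D 1))
    have hδ1 : (max D 1)⁻¹ ≤ 1 := inv_le_one_of_one_le₀ (le_max_right D 1)
    have hK : 0 < s * (s + 1) * (max D 1)⁻¹ ^ (-(s + 1 + 1)) / 4 := by positivity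
    refine ⟨(s * (s + 1) * (max D 1)⁻¹ ^ (-(s + 1 + 1)) / 4)⁻¹, inv_pos.2 hK,
      fun w hw a b hab hi hd => ?_⟩
    have h := sub_le_mul_tsum_buckleyLevel hw hab hs hi hδ hδ1
      ((inv_inv (max D 1)).symm ▸ hd.mono hw hab (le_max_left D 1))
    have h' := mul_le_mul_of_nonneg_left h (inv_pos.2 (sub_pos.2 hab)).le
    rw [mul_left_comm, ← avg_sub_eq _ hab] at h'
    exact (inv_mul_le_iff₀ hK).2 h'
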